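/- Let H be a complex Hilbert space, let V ∈ B(H) be a self-adjoint unitary, let 𝔅, 𝔄 ⊆ B(H) be closed subalgebras, and let 𝔛 ⊆ B(H) be a closed subspace such that: {V b* V : b ∈ 𝔅} = 𝔅; {V a* V : a ∈ 𝔄} = 𝔄; 𝔄·𝔛 ⊆ 𝔛; 𝔛·𝔅 ⊆ 𝔛; and V x* V y ∈ 𝔅 for all x, y ∈ 𝔛. Let 𝔎 ⊆ B(H) be the closed linear span of {x·(V y* V) : x, y ∈ 𝔛}, and let ℒ ⊆ B(H ⊕ H) be the operator-norm closure of the set of block operators [[b, V x* V],[y, a + k]] with b ∈ 𝔅, x, y ∈ 𝔛, a ∈ 𝔄, k ∈ 𝔎. Then ℒ is a closed subalgebra of B(H ⊕ H), and with W := V ⊕ V one has {W L* W : L ∈ ℒ} = ℒ; in particular L ↦ W L* W is a conjugate-linear anti-multiplicative involution on ℒ. -/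

import Mathlib

open scoped ComplexConjugate
open ContinuousLinearMap

/-- The block operator `[[A, B],[C, D]]` on the Hilbert space direct sum `H ⊕ H`. -/
noncomputable def blockOp {H : Type*} [NormedAddCommGroup H] [InnerProductSpace ℂ H]
    (A B C D : H →L[ℂ] H) : WithLp 2 (H × H) →L[ℂ] WithLp 2 (H × H) :=
  ((WithLp.prodContinuousLinearEquiv 2 ℂ H H).symm : (H × H) →L[ℂ] WithLp 2 (H × H)) ∘L
    ((A ∘L ContinuousLinearMap.fst ℂ H H + B ∘L ContinuousLinearMap.snd ℂ H H).prod
      (C ∘L ContinuousLinearMap.fst ℂ H H + D ∘L ContinuousLinearMap.snd ℂ H H)) ∘L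
    ((WithLp.prodContinuousLinearEquiv 2 ℂ H H) : WithLp 2 (H × H) →L[ℂ] H × H)

/-- The map `T ↦ V T* V`, as a continuous conjugate-linear map. -/
noncomputable def twistedAdjoint {E : Type*} [NormedAddCommGroup E] [InnerProductSpace ℂ E]
    [CompleteSpace E] (V : E →L[ℂ] E) : (E →L[ℂ] E) →L⋆[ℂ] (E →L[ℂ] E) where
  toFun T := V * adjoint T * V
  map_add' S T := by rw [map_add, mul_add, add_mul]
  map_smul' c T := by
    rw [LinearIsometryEquiv.map_smulₛₗ, mul_smul_comm, smul_mul_assoc]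
  cont := by
    have h : Continuous fun T : E →L[ℂ] E => adjoint T := adjoint.continuous
    fun_prop

section TwistedAdjoint

variable {E : Type*} [NormedAddCommGroup E] [InnerProductSpace ℂ E] [CompleteSpace E]
  {V : E →L[ℂ] E}

theorem twistedAdjoint_apply (T : E →L[ℂ] E) : twistedAdjoint V T = V * adjoint T * V := rfl

theorem twistedAdjoint_mul (hV : V * V = 1) (S T : E →L[ℂ] E) :
    twistedAdjoint V (S * T) = twistedAdjoint V T * twistedAdjoint V S := by
  have h : adjoint (S * T) = adjoint T * adjoint S := adjoint_comp S T
  simp only [twistedAdjoint_apply, h]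
  calc V * (adjoint T * adjoint S) * V = V * adjoint T * 1 * adjoint S * V := by
        simp only [mul_assoc, one_mul]
    _ = _ := by rw [← hV]; simp only [mul_assoc]

theorem twistedAdjoint_twistedAdjoint (hV_sa : adjoint V = V) (hV : V * V = 1) (T : E →L[ℂ] E) :
    twistedAdjoint V (twistedAdjoint V T) = T := by
  have hVV : twistedAdjoint V V = V := by rw [twistedAdjoint_apply, hV_sa, hV, one_mul]
  have hT : twistedAdjoint V (adjoint T) = V * T * V := by
    rw [twistedAdjoint_apply, adjoint_adjoint]
  rw [twistedAdjoint_apply T, twistedAdjoint_mul hV, twistedAdjoint_mul hV, hVV, hT,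
    ← mul_assoc, ← mul_assoc, ← mul_assoc, hV, one_mul, mul_assoc, hV, mul_one]

theorem image_twistedAdjoint_eq (hV_sa : adjoint V = V) (hV : V * V = 1)
    {s : Set (E →L[ℂ] E)} (hs : ∀ T ∈ s, twistedAdjoint V T ∈ s) :
    twistedAdjoint V '' s = s :=
  Set.Subset.antisymm (Set.image_subset_iff.2 hs) fun T hT =>
    ⟨_, hs T hT, twistedAdjoint_twistedAdjoint hV_sa hV T⟩

end TwistedAdjoint

section BlockOp

variable {H : Type*} [NormedAddCommGroup H] [InnerProductSpace ℂ H]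

@[simp]
theorem blockOp_apply_fst (A B C D : H →L[ℂ] H) (u : WithLp 2 (H × H)) :
    (blockOp A B C D u).fst = A u.fst + B u.snd := rfl

@[simp]
theorem blockOp_apply_snd (A B C D : H →L[ℂ] H) (u : WithLp 2 (H × H)) :
    (blockOp A B C D u).snd = C u.fst + D u.snd := rfl

theorem continuousLinearMap_withLp_prod_ext {S T : WithLp 2 (H × H) →L[ℂ] WithLp 2 (H × H)}
    (h₁ : ∀ u, (S u).fst = (T u).fst) (h₂ : ∀ u, (S u).snd = (T u).snd) : S = T :=
  ContinuousLinearMap.ext fun u => WithLp.ofLp_injective 2 (Prod.ext (h₁ u) (h₂ u))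

theorem blockOp_add (A B C D A' B' C' D' : H →L[ℂ] H) :
    blockOp A B C D + blockOp A' B' C' D' = blockOp (A + A') (B + B') (C + C') (D + D') := by
  apply continuousLinearMap_withLp_prod_ext <;> intro u <;> simp <;> abel

theorem smul_blockOp (c : ℂ) (A B C D : H →L[ℂ] H) :
    c • blockOp A B C D = blockOp (c • A) (c • B) (c • C) (c • D) := by
  apply continuousLinearMap_withLp_prod_ext <;> intro u <;> simp

theorem blockOp_mul (A B C D A' B' C' D' : H →L[ℂ] H) :
    blockOp A B C D * blockOp A' B' C' D' =
      blockOp (A * A' + B * C') (A * B' + B * D') (C * A' + D * C') (C * B' + D * D') := by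
  apply continuousLinearMap_withLp_prod_ext <;> intro u <;> simp <;> abel

theorem blockOp_one : blockOp (1 : H →L[ℂ] H) 0 0 1 = 1 := by
  apply continuousLinearMap_withLp_prod_ext <;> intro u <;> simp

theorem adjoint_blockOp [CompleteSpace H] (A B C D : H →L[ℂ] H) :
    adjoint (blockOp A B C D) = blockOp (adjoint A) (adjoint C) (adjoint B) (adjoint D) := by
  symm
  rw [eq_adjoint_iff]
  intro u v
  have h (z w : WithLp 2 (H × H)) : inner ℂ z w = inner ℂ z.fst w.fst + inner ℂ z.snd w.snd :=
    WithLp.prod_inner_apply z w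
  simp only [h, blockOp_apply_fst, blockOp_apply_snd, inner_add_left, inner_add_right,
    adjoint_inner_left]
  ring

theorem twistedAdjoint_blockOp [CompleteSpace H] (V A B C D : H →L[ℂ] H) :
    twistedAdjoint (blockOp V 0 0 V) (blockOp A B C D) =
      blockOp (twistedAdjoint V A) (twistedAdjoint V C) (twistedAdjoint V B)
        (twistedAdjoint V D) := by
  simp [twistedAdjoint_apply, adjoint_blockOp, blockOp_mul]

end BlockOp

/-- **The linking algebra of a standard form representation is an operator `*`-algebra**
(Definition 5.10 and Lemma 5.11). Given a self-adjoint unitary `V`, closed subalgebras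
`𝔅, 𝔄 ⊆ B(H)` invariant under `b ↦ V b* V`, and a closed subspace `𝔛` with `𝔄·𝔛 ⊆ 𝔛`,
`𝔛·𝔅 ⊆ 𝔛` and `V x* V y ∈ 𝔅`, the operator-norm closure `ℒ` of the set of block operators
`[[b, V x* V],[y, a + k]]` (with `k` in the closed span `𝔎` of `{x (V y* V)}`) is a closed
subalgebra of `B(H ⊕ H)` invariant under `L ↦ W L* W`, `W = V ⊕ V`, and this map is a
conjugate-linear anti-multiplicative involution. -/
theorem linking_operator_star_algebra
    (H : Type) [NormedAddCommGroup H] [InnerProductSpace ℂ H] [CompleteSpace H]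
    (V : H →L[ℂ] H) (hV_sa : adjoint V = V) (hV_unit : V * V = 1)
    (𝔅 𝔄 : NonUnitalSubalgebra ℂ (H →L[ℂ] H))
    (h𝔅_closed : IsClosed (𝔅 : Set (H →L[ℂ] H)))
    (h𝔄_closed : IsClosed (𝔄 : Set (H →L[ℂ] H)))
    (𝔛 : Submodule ℂ (H →L[ℂ] H)) (h𝔛_closed : IsClosed (𝔛 : Set (H →L[ℂ] H)))
    (h𝔅_dag : (fun b => V * adjoint b * V) '' (𝔅 : Set (H →L[ℂ] H)) = 𝔅)
    (h𝔄_dag : (fun a => V * adjoint a * V) '' (𝔄 : Set (H →L[ℂ] H)) = 𝔄)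
    (h𝔄𝔛 : ∀ a ∈ 𝔄, ∀ x ∈ 𝔛, a * x ∈ 𝔛)
    (h𝔛𝔅 : ∀ x ∈ 𝔛, ∀ b ∈ 𝔅, x * b ∈ 𝔛)
    (hinn : ∀ x ∈ 𝔛, ∀ y ∈ 𝔛, V * adjoint x * V * y ∈ 𝔅)
    -- `𝔎` is the closed linear span of `{x · (V y* V) : x, y ∈ 𝔛}`
    (𝔎 : Submodule ℂ (H →L[ℂ] H))
    (h𝔎 : 𝔎 = (Submodule.span ℂ
      {z : H →L[ℂ] H | ∃ x ∈ 𝔛, ∃ y ∈ 𝔛, z = x * (V * adjoint y * V)}).topologicalClosure)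
    -- `ℒ` is the operator-norm closure of the set of block operators
    (ℒ : Set (WithLp 2 (H × H) →L[ℂ] WithLp 2 (H × H)))
    (hℒ : ℒ = closure {L | ∃ b ∈ 𝔅, ∃ x ∈ 𝔛, ∃ y ∈ 𝔛, ∃ a ∈ 𝔄, ∃ k ∈ 𝔎,
      L = blockOp b (V * adjoint x * V) y (a + k)})
    (W : WithLp 2 (H × H) →L[ℂ] WithLp 2 (H × H)) (hW : W = blockOp V 0 0 V) :
    -- `ℒ` is a closed subalgebra of `B(H ⊕ H)`
    IsClosed ℒ ∧
    (∀ L ∈ ℒ, ∀ L' ∈ ℒ, L + L' ∈ ℒ) ∧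
    (∀ (c : ℂ), ∀ L ∈ ℒ, c • L ∈ ℒ) ∧
    (∀ L ∈ ℒ, ∀ L' ∈ ℒ, L * L' ∈ ℒ) ∧
    -- `ℒ` is invariant under `L ↦ W L* W`
    (fun L => W * adjoint L * W) '' ℒ = ℒ ∧
    -- `L ↦ W L* W` is a conjugate-linear anti-multiplicative involution
    (∀ L L', W * adjoint (L + L') * W = W * adjoint L * W + W * adjoint L' * W) ∧
    (∀ (c : ℂ) (L), W * adjoint (c • L) * W = conj c • (W * adjoint L * W)) ∧
    (∀ L L', W * adjoint (L * L') * W = (W * adjoint L' * W) * (W * adjoint L * W)) ∧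
    (∀ L, W * adjoint (W * adjoint L * W) * W = L) := by
  have hW_sa : adjoint W = W := by rw [hW, adjoint_blockOp, hV_sa, map_zero]
  have hW_unit : W * W = 1 := by simp [hW, blockOp_mul, hV_unit, blockOp_one]
  have h𝔅τ : ∀ b ∈ 𝔅, twistedAdjoint V b ∈ 𝔅 := fun b hb =>
    (Set.ext_iff.1 h𝔅_dag _).1 ⟨b, hb, rfl⟩
  have h𝔄τ : ∀ a ∈ 𝔄, twistedAdjoint V a ∈ 𝔄 := fun a ha =>
    (Set.ext_iff.1 h𝔄_dag _).1 ⟨a, ha, rfl⟩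
  have hinnτ : ∀ x ∈ 𝔛, ∀ y ∈ 𝔛, twistedAdjoint V x * y ∈ 𝔅 := hinn
  have hττ := twistedAdjoint_twistedAdjoint hV_sa hV_unit
  have hτmul := twistedAdjoint_mul hV_unit
  have h𝔎_closed : IsClosed (𝔎 : Set (H →L[ℂ] H)) :=
    h𝔎 ▸ Submodule.isClosed_topologicalClosure _
  have h𝔎_gen : ∀ x ∈ 𝔛, ∀ y ∈ 𝔛, x * twistedAdjoint V y ∈ 𝔎 := fun x hx y hy =>
    h𝔎 ▸ Submodule.le_topologicalClosure _ (Submodule.subset_span ⟨x, hx, y, hy, rfl⟩)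
  -- closed subspaces containing the images of the generators contain the image of `𝔎`
  have h𝔎_ind : ∀ {σ : ℂ →+* ℂ} (f : (H →L[ℂ] H) →SL[σ] (H →L[ℂ] H))
      (P : Submodule ℂ (H →L[ℂ] H)), IsClosed (P : Set (H →L[ℂ] H)) →
      (∀ x ∈ 𝔛, ∀ y ∈ 𝔛, f (x * twistedAdjoint V y) ∈ P) → ∀ k ∈ 𝔎, f k ∈ P := by
    intro σ f P hP hf
    have h : 𝔎 ≤ P.comap (f : (H →L[ℂ] H) →ₛₗ[σ] (H →L[ℂ] H)) := by
      rw [h𝔎]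
      refine Submodule.topologicalClosure_minimal _ (Submodule.span_le.2 ?_)
        (hP.preimage f.continuous)
      rintro _ ⟨x, hx, y, hy, rfl⟩
      exact hf x hx y hy
    exact h
  have h𝔎τ : ∀ k ∈ 𝔎, twistedAdjoint V k ∈ 𝔎 :=
    h𝔎_ind (twistedAdjoint V) 𝔎 h𝔎_closed fun x hx y hy => by
      rw [hτmul, hττ]
      exact h𝔎_gen y hy x hx
  have h𝔎𝔛 : ∀ k ∈ 𝔎, ∀ z ∈ 𝔛, k * z ∈ 𝔛 := fun k hk z hz =>
    h𝔎_ind ((ContinuousLinearMap.mul ℂ (H →L[ℂ] H)).flip z) 𝔛 h𝔛_closed (fun x hx y hy => by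
      rw [flip_apply, mul_apply', mul_assoc]
      exact h𝔛𝔅 x hx _ (hinnτ y hy z hz)) k hk
  have h𝔎_mul_left : ∀ T : H →L[ℂ] H, (∀ x ∈ 𝔛, T * x ∈ 𝔛) → ∀ k ∈ 𝔎, T * k ∈ 𝔎 :=
    fun T hT => h𝔎_ind (ContinuousLinearMap.mul ℂ (H →L[ℂ] H) T) 𝔎 h𝔎_closed
      fun x hx y hy => by
        rw [mul_apply', ← mul_assoc]
        exact h𝔎_gen _ (hT x hx) y hy
  have h𝔎𝔄 : ∀ k ∈ 𝔎, ∀ a ∈ 𝔄, k * a ∈ 𝔎 := fun k hk a ha => by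
    rw [← hττ (k * a), hτmul]
    exact h𝔎τ _ (h𝔎_mul_left _ (h𝔄𝔛 _ (h𝔄τ a ha)) _ (h𝔎τ k hk))
  set S : Set (WithLp 2 (H × H) →L[ℂ] WithLp 2 (H × H)) :=
    {L | ∃ b ∈ 𝔅, ∃ x ∈ 𝔛, ∃ y ∈ 𝔛, ∃ a ∈ 𝔄, ∃ k ∈ 𝔎,
      L = blockOp b (twistedAdjoint V x) y (a + k)}
  replace hℒ : ℒ = closure S := hℒ
  have hS_add : ∀ L ∈ S, ∀ L' ∈ S, L + L' ∈ S := by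
    rintro _ ⟨b, hb, x, hx, y, hy, a, ha, k, hk, rfl⟩ _
      ⟨b', hb', x', hx', y', hy', a', ha', k', hk', rfl⟩
    refine ⟨b + b', add_mem hb hb', x + x', add_mem hx hx', y + y', add_mem hy hy',
      a + a', add_mem ha ha', k + k', add_mem hk hk', ?_⟩
    rw [blockOp_add, map_add, add_add_add_comm]
  have hS_smul : ∀ c : ℂ, ∀ L ∈ S, c • L ∈ S := by
    rintro c _ ⟨b, hb, x, hx, y, hy, a, ha, k, hk, rfl⟩
    refine ⟨c • b, 𝔅.smul_mem c hb, conj c • x, 𝔛.smul_mem _ hx, c • y, 𝔛.smul_mem _ hy,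
      c • a, 𝔄.smul_mem c ha, c • k, 𝔎.smul_mem _ hk, ?_⟩
    rw [smul_blockOp, map_smulₛₗ, Complex.conj_conj, smul_add]
  have hS_mul : ∀ L ∈ S, ∀ L' ∈ S, L * L' ∈ S := by
    rintro _ ⟨b, hb, x, hx, y, hy, a, ha, k, hk, rfl⟩ _
      ⟨b', hb', x', hx', y', hy', a', ha', k', hk', rfl⟩
    refine ⟨b * b' + twistedAdjoint V x * y', add_mem (mul_mem hb hb') (hinnτ x hx y' hy'),
      x' * twistedAdjoint V b + (twistedAdjoint V a' * x + twistedAdjoint V k' * x),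
      add_mem (h𝔛𝔅 _ hx' _ (h𝔅τ b hb))
        (add_mem (h𝔄𝔛 _ (h𝔄τ a' ha') _ hx) (h𝔎𝔛 _ (h𝔎τ k' hk') _ hx)),
      y * b' + (a * y' + k * y'),
      add_mem (h𝔛𝔅 _ hy _ hb') (add_mem (h𝔄𝔛 _ ha _ hy') (h𝔎𝔛 _ hk _ hy')),
      a * a', mul_mem ha ha',
      y * twistedAdjoint V x' + (a * k' + k * a' + k * k'),
      add_mem (h𝔎_gen y hy x' hx') (add_mem (add_mem (h𝔎_mul_left a (h𝔄𝔛 a ha) k' hk')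
        (h𝔎𝔄 k hk a' ha')) (h𝔎_mul_left k (h𝔎𝔛 k hk) k' hk')), ?_⟩
    rw [blockOp_mul]
    congr 1
    · simp only [map_add, hτmul, hττ, mul_add]
    · simp only [add_mul, mul_add]
      abel
  have hS_τ : ∀ L ∈ S, twistedAdjoint W L ∈ S := by
    rintro _ ⟨b, hb, x, hx, y, hy, a, ha, k, hk, rfl⟩
    refine ⟨_, h𝔅τ b hb, y, hy, x, hx, _, h𝔄τ a ha, _, h𝔎τ k hk, ?_⟩
    rw [hW, twistedAdjoint_blockOp, hττ, map_add]
  refine ⟨hℒ ▸ isClosed_closure, ?_, ?_, ?_, ?_, map_add (twistedAdjoint W),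
    map_smulₛₗ (twistedAdjoint W), twistedAdjoint_mul hW_unit,
    twistedAdjoint_twistedAdjoint hW_sa hW_unit⟩
  · rw [hℒ]
    exact fun L hL L' hL' => map_mem_closure₂ continuous_add hL hL' hS_add
  · rw [hℒ]
    exact fun c L hL => map_mem_closure (continuous_const_smul c) hL (hS_smul c)
  · rw [hℒ]
    exact fun L hL L' hL' => map_mem_closure₂ continuous_mul hL hL' hS_mul
  · rw [hℒ]
    exact image_twistedAdjoint_eq hW_sa hW_unit fun L hL =>
      map_mem_closure (twistedAdjoint W).continuous hL hS_τ
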